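/- For each pattern index i and each n ≥ 1: f_{i,n} = Σ_{j≠i} Σ_{ℓ=1}^{n} x_{j,ℓ} · f^{(j)}_{i,n−ℓ} + x_{i,n}, where f_{i,n} = μ(T_{S_i} = n), x_{j,ℓ} is the probability that pattern j wins the game at trial ℓ, and f^{(j)}_{i,m} = μ(T_{S_i | S_j⊓S_i} = m) is the head-start first-occurrence probability of pattern i given head start S_j⊓S_i. -/

import Mathlib

open MeasureTheory ENNReal

def occursAt (S : List Bool) (ω : ℕ → Bool) (n : ℕ) : Prop :=
  S.length ≤ n ∧ ∀ j < S.length, ω (n - S.length + j) = S.getD j false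

noncomputable def firstOcc (S : List Bool) (ω : ℕ → Bool) : ℕ∞ :=
  ⨅ (n : ℕ) (_ : occursAt S ω n), (n : ℕ∞)

noncomputable def f (μ : Measure (ℕ → Bool)) (S : List Bool) (n : ℕ) : ℝ≥0∞ :=
  μ {ω | firstOcc S ω = (n : ℕ∞)}

/-- The concatenated sequence `C ⌢ ω`. -/
def catSeq (C : List Bool) (ω : ℕ → Bool) : ℕ → Bool :=
  fun i => if i < C.length then C.getD i false else ω (i - C.length)

/-- The head-start first-occurrence time `T_{S|C}`. -/
noncomputable def headOcc (S C : List Bool) (ω : ℕ → Bool) : ℕ∞ :=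
  ⨅ (n : ℕ) (_ : 1 ≤ n ∧ occursAt S (catSeq C ω) (C.length + n)), (n : ℕ∞)

noncomputable def fCond (μ : Measure (ℕ → Bool)) (S C : List Bool) (n : ℕ) : ℝ≥0∞ :=
  μ {ω | headOcc S C ω = (n : ℕ∞)}

/-- The overlap set `W ⊡ S`. -/
def overlaps (W S : List Bool) : Finset ℕ :=
  (Finset.Icc 1 (min W.length S.length)).filter fun i => W.drop (W.length - i) = S.take i

/-- `W ⊛ S`: the largest overlap shift (0 if there is none). -/
def maxOverlap (W S : List Bool) : ℕ := (overlaps W S).sup id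

/-- `W ⊓ S`: the prefix of `S` of length `W ⊛ S`. -/
def sqcap (W S : List Bool) : List Bool := S.take (maxOverlap W S)

/-- Pattern `i` wins the game at trial `n`: `S i` occurs ending at trial `n` and no
pattern occurs ending at any earlier trial. -/
def winsAt {m : ℕ} (S : Fin m → List Bool) (i : Fin m) (ω : ℕ → Bool) (n : ℕ) : Prop :=
  occursAt (S i) ω n ∧ ∀ j : Fin m, ∀ l < n, ¬ occursAt (S j) ω l

noncomputable def x {m : ℕ} (μ : Measure (ℕ → Bool)) (S : Fin m → List Bool)
    (i : Fin m) (n : ℕ) : ℝ≥0∞ :=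
  μ {ω | winsAt S i ω n}

lemma iInf_natCast_eq_iff (P : ℕ → Prop) (k : ℕ) :
    (⨅ (n : ℕ) (_ : P n), (n : ℕ∞)) = (k : ℕ∞) ↔ P k ∧ ∀ l < k, ¬ P l := by
  classical
  by_cases h : ∃ n, P n
  · have hfind : (⨅ (n : ℕ) (_ : P n), (n : ℕ∞)) = (Nat.find h : ℕ∞) :=
      le_antisymm (iInf₂_le _ (Nat.find_spec h))
        (le_iInf₂ fun n hn => by exact_mod_cast Nat.find_min' h hn)
    rw [hfind, Nat.cast_inj, Nat.find_eq_iff]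
  · push Not at h
    simp [h]

lemma firstOcc_eq_iff (S : List Bool) (ω : ℕ → Bool) (n : ℕ) :
    firstOcc S ω = (n : ℕ∞) ↔ occursAt S ω n ∧ ∀ l < n, ¬ occursAt S ω l :=
  iInf_natCast_eq_iff _ _

lemma headOcc_eq_iff (S C : List Bool) (ω : ℕ → Bool) (n : ℕ) :
    headOcc S C ω = (n : ℕ∞) ↔
      (1 ≤ n ∧ occursAt S (catSeq C ω) (C.length + n)) ∧
        ∀ l < n, ¬ (1 ≤ l ∧ occursAt S (catSeq C ω) (C.length + l)) :=
  iInf_natCast_eq_iff _ _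

lemma occursAt_congr {S : List Bool} {ω ω' : ℕ → Bool} {n : ℕ}
    (h : ∀ k < n, ω k = ω' k) : occursAt S ω n ↔ occursAt S ω' n := by
  unfold occursAt
  refine and_congr_right fun hn => forall₂_congr fun j hj => ?_
  rw [h _ (by omega)]

lemma winsAt_congr {m : ℕ} {S : Fin m → List Bool} {i : Fin m} {ω ω' : ℕ → Bool} {n : ℕ}
    (h : ∀ k < n, ω k = ω' k) : winsAt S i ω n ↔ winsAt S i ω' n := by
  unfold winsAt
  refine and_congr (occursAt_congr h) (forall_congr' fun j => forall₂_congr fun l hl => ?_)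
  rw [occursAt_congr fun k hk => h k (hk.trans hl)]

lemma headOcc_congr {S C : List Bool} {ω ω' : ℕ → Bool} {n : ℕ}
    (h : ∀ k < n, ω k = ω' k) :
    headOcc S C ω = (n : ℕ∞) ↔ headOcc S C ω' = (n : ℕ∞) := by
  have hocc : ∀ l ≤ n, (occursAt S (catSeq C ω) (C.length + l) ↔
      occursAt S (catSeq C ω') (C.length + l)) := fun l hl =>
    occursAt_congr fun k hk => by
      unfold catSeq
      split_ifs
      · rfl
      · exact h _ (by omega)
  rw [headOcc_eq_iff, headOcc_eq_iff, hocc n le_rfl]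
  refine and_congr_right' (forall₂_congr fun l hl => ?_)
  rw [hocc l hl.le]

lemma isInfix_of_getD_eq {S T : List Bool} {o : ℕ} (ho : o + T.length ≤ S.length)
    (h : ∀ t < T.length, S.getD (o + t) false = T.getD t false) : T <:+: S := by
  have hT : T = (S.drop o).take T.length := by
    refine List.ext_getElem (by simp; omega) fun t h₁ h₂ => ?_
    have := h t h₁
    rw [List.getD_eq_getElem _ _ (by omega), List.getD_eq_getElem _ _ h₁] at this
    simp [this]
  rw [hT]
  exact (List.take_prefix _ _).isInfix.trans (List.drop_suffix _ _).isInfix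

lemma occursAt.isInfix {S T : List Bool} {ω : ℕ → Bool} {a b : ℕ}
    (hT : occursAt T ω a) (hS : occursAt S ω b) (hab : a ≤ b)
    (hstart : b + T.length ≤ a + S.length) : T <:+: S := by
  obtain ⟨hTa, hT⟩ := hT
  obtain ⟨hSb, hS⟩ := hS
  refine isInfix_of_getD_eq (o := a + S.length - T.length - b) (by omega) fun t ht => ?_
  rw [← hT t ht, ← hS _ (by omega)]
  congr 1
  omega

lemma getD_eq_of_mem_overlaps {W S : List Bool} {r t : ℕ} (hr : r ∈ overlaps W S) (ht : t < r) :
    W.getD (W.length - r + t) false = S.getD t false := by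
  simp only [overlaps, Finset.mem_filter, Finset.mem_Icc, le_min_iff] at hr
  obtain ⟨⟨-, hW, hS⟩, h⟩ := hr
  have := congrArg (fun l => l[t]?) h
  simp only [List.getElem?_drop, List.getElem?_take, ht, if_true] at this
  simp [List.getD_eq_getElem?_getD, this]

lemma mem_overlaps_of_getD_eq {W S : List Bool} {r : ℕ} (hr : 1 ≤ r) (hW : r ≤ W.length)
    (hS : r ≤ S.length)
    (h : ∀ t < r, W.getD (W.length - r + t) false = S.getD t false) : r ∈ overlaps W S := by
  simp only [overlaps, Finset.mem_filter, Finset.mem_Icc, le_min_iff]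
  refine ⟨⟨hr, hW, hS⟩, List.ext_getElem (by simp; omega) fun t h₁ h₂ => ?_⟩
  have htr : t < r := by simp at h₂; omega
  have := h t htr
  rw [List.getD_eq_getElem _ _ (by omega), List.getD_eq_getElem _ _ (by omega)] at this
  simpa using this

lemma le_maxOverlap {W S : List Bool} {r : ℕ} (hr : r ∈ overlaps W S) : r ≤ maxOverlap W S :=
  Finset.le_sup (f := id) hr

lemma maxOverlap_eq_zero_or_mem (W S : List Bool) :
    maxOverlap W S = 0 ∨ maxOverlap W S ∈ overlaps W S := by
  rcases (overlaps W S).eq_empty_or_nonempty with h | h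
  · left
    simp [maxOverlap, h]
  · right
    obtain ⟨r, hr, h⟩ := Finset.exists_mem_eq_sup _ h id
    rw [maxOverlap, h]
    exact hr

lemma maxOverlap_le (W S : List Bool) :
    maxOverlap W S ≤ W.length ∧ maxOverlap W S ≤ S.length := by
  rcases maxOverlap_eq_zero_or_mem W S with h | h
  · omega
  · simp only [overlaps, Finset.mem_filter, Finset.mem_Icc, le_min_iff] at h
    exact h.1.2

lemma length_sqcap (W S : List Bool) : (sqcap W S).length = maxOverlap W S := by
  simp [sqcap, (maxOverlap_le W S).2]

/-- The sequence seen after the first `l` trials. -/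
def shiftSeq (l : ℕ) (ω : ℕ → Bool) : ℕ → Bool := fun k => ω (l + k)

lemma catSeq_sqcap_shiftSeq {W S : List Bool} {ω : ℕ → Bool} {l : ℕ} (hW : occursAt W ω l)
    (u : ℕ) : catSeq (sqcap W S) (shiftSeq l ω) u = ω (l - maxOverlap W S + u) := by
  have hle := maxOverlap_le W S
  obtain ⟨hl, hW⟩ := hW
  unfold catSeq shiftSeq
  rw [length_sqcap]
  split_ifs with hu
  · have hmem := (maxOverlap_eq_zero_or_mem W S).resolve_left (by omega)
    have h₁ := getD_eq_of_mem_overlaps hmem hu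
    rw [← hW _ (by omega)] at h₁
    have h₂ : (sqcap W S).getD u false = S.getD u false := by
      simp [sqcap, List.getD_eq_getElem?_getD, hu]
    rw [h₂, ← h₁]
    congr 1
    omega
  · congr 1
    omega

/-- After an occurrence of `W`, the later occurrences of `S` depend on the past only through the
head start `W ⊓ S`. -/
lemma occursAt_add_iff {W S : List Bool} {ω : ℕ → Bool} {l k : ℕ} (hW : occursAt W ω l)
    (hWS : ¬ W <:+: S) (hk : 1 ≤ k) :
    occursAt S ω (l + k) ↔
      occursAt S (catSeq (sqcap W S) (shiftSeq l ω)) ((sqcap W S).length + k) := by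
  have hle := maxOverlap_le W S
  have hl := hW.1
  have hlen : occursAt S ω (l + k) → S.length ≤ maxOverlap W S + k := fun hS => by
    by_contra! hlt
    have hr : S.length - k < W.length := by
      by_contra! hge
      exact hWS (hW.isInfix hS (by omega) (by omega))
    have hmem : S.length - k ∈ overlaps W S := by
      refine mem_overlaps_of_getD_eq (by omega) hr.le (by omega) fun t ht => ?_
      rw [← hW.2 _ (by omega), ← hS.2 _ (by omega)]
      congr 1
      omega
    have := le_maxOverlap hmem
    omega
  have hshift : ∀ j, S.length ≤ maxOverlap W S + k →
      l - maxOverlap W S + (maxOverlap W S + k - S.length + j) = l + k - S.length + j := by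
    intro j hj
    omega
  rw [length_sqcap]
  refine ⟨fun hS => ⟨hlen hS, fun j hj => ?_⟩, fun hS => ⟨by have := hS.1; omega, fun j hj => ?_⟩⟩
  · rw [catSeq_sqcap_shiftSeq hW, hshift j (hlen hS), hS.2 j hj]
  · rw [← hS.2 j hj, catSeq_sqcap_shiftSeq hW, hshift j hS.1]

section Game

variable {m : ℕ} {S : Fin m → List Bool}

lemma winsAt_unique (hsub : ∀ i j, i ≠ j → ¬ S i <:+: S j) {ω : ℕ → Bool} {i j : Fin m} {k l : ℕ}
    (hi : winsAt S i ω k) (hj : winsAt S j ω l) : i = j ∧ k = l := by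
  obtain rfl : k = l := by
    by_contra hne
    rcases lt_or_gt_of_ne hne with h | h
    · exact hj.2 i k h hi.1
    · exact hi.2 j l h hj.1
  refine ⟨?_, rfl⟩
  by_contra hne
  rcases le_total (S i).length (S j).length with h | h
  · exact hsub i j hne (hi.1.isInfix hj.1 le_rfl (by omega))
  · exact hsub j i (Ne.symm hne) (hj.1.isInfix hi.1 le_rfl (by omega))

lemma not_occursAt_of_winsAt (hsub : ∀ i j, i ≠ j → ¬ S i <:+: S j) {ω : ℕ → Bool}
    {i j : Fin m} {k l : ℕ} (hij : i ≠ j) (hj : winsAt S j ω l) (hk : k ≤ l) :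
    ¬ occursAt (S i) ω k := fun hi => by
  rcases hk.lt_or_eq with h | rfl
  · exact hj.2 i k h hi
  · exact hij (winsAt_unique hsub ⟨hi, hj.2⟩ hj).1

lemma firstOcc_eq_iff_headOcc_of_winsAt (hsub : ∀ i j, i ≠ j → ¬ S i <:+: S j) {ω : ℕ → Bool}
    {i j : Fin m} {l n : ℕ} (hij : i ≠ j) (hj : winsAt S j ω l) (hln : l ≤ n) :
    firstOcc (S i) ω = (n : ℕ∞) ↔
      headOcc (S i) (sqcap (S j) (S i)) (shiftSeq l ω) = ((n - l : ℕ) : ℕ∞) := by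
  have hno : ∀ k ≤ l, ¬ occursAt (S i) ω k := fun k => not_occursAt_of_winsAt hsub hij hj
  have hiff : ∀ k, (1 ≤ k ∧ occursAt (S i) (catSeq (sqcap (S j) (S i)) (shiftSeq l ω))
      ((sqcap (S j) (S i)).length + k)) ↔ occursAt (S i) ω (l + k) := fun k => by
    rcases Nat.eq_zero_or_pos k with rfl | hk
    · simp [hno l le_rfl]
    · rw [occursAt_add_iff hj.1 (hsub j i hij.symm) hk]
      simp [Nat.succ_le_of_lt hk]
  rw [firstOcc_eq_iff, headOcc_eq_iff]
  simp only [hiff]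
  rw [Nat.add_sub_cancel' hln]
  refine and_congr_right' ⟨fun h k hk => h _ (by omega), fun h k hk => ?_⟩
  rcases le_total k l with hkl | hkl
  · exact hno k hkl
  · obtain ⟨t, rfl⟩ := Nat.exists_eq_add_of_le hkl
    exact h t (by omega)

lemma firstOcc_eq_iff_winsAt (hS : ∀ i, S i ≠ []) (hsub : ∀ i j, i ≠ j → ¬ S i <:+: S j)
    (ω : ℕ → Bool) (i : Fin m) (n : ℕ) :
    firstOcc (S i) ω = (n : ℕ∞) ↔
      (∃ j ≠ i, ∃ l ∈ Finset.Icc 1 n, winsAt S j ω l ∧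
        headOcc (S i) (sqcap (S j) (S i)) (shiftSeq l ω) = ((n - l : ℕ) : ℕ∞)) ∨
      winsAt S i ω n := by
  classical
  constructor
  · intro h
    have hfirst := (firstOcc_eq_iff _ _ _).1 h
    by_cases hex : ∃ l < n, ∃ j, occursAt (S j) ω l
    · have hex' : ∃ l, ∃ j, occursAt (S j) ω l := hex.imp fun _ => And.right
      obtain ⟨j, hj⟩ := Nat.find_spec hex'
      have hlt : Nat.find hex' < n := by
        obtain ⟨l, hl, hocc⟩ := hex
        exact (Nat.find_min' hex' hocc).trans_lt hl
      have hwin : winsAt S j ω (Nat.find hex') :=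
        ⟨hj, fun j' l hl hocc => Nat.find_min hex' hl ⟨j', hocc⟩⟩
      have hne : j ≠ i := by
        rintro rfl
        exact hfirst.2 _ hlt hj
      have hpos := (List.length_pos_of_ne_nil (hS j)).trans_le hj.1
      exact Or.inl ⟨j, hne, _, Finset.mem_Icc.2 ⟨hpos, hlt.le⟩, hwin,
        (firstOcc_eq_iff_headOcc_of_winsAt hsub hne.symm hwin hlt.le).1 h⟩
    · push Not at hex
      exact Or.inr ⟨hfirst.1, fun j l hl => hex l hl j⟩
  · rintro (⟨j, hne, l, hl, hwin, h⟩ | h)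
    · exact (firstOcc_eq_iff_headOcc_of_winsAt hsub hne.symm hwin (Finset.mem_Icc.1 hl).2).2 h
    · exact (firstOcc_eq_iff _ _ _).2 ⟨h.1, h.2 i⟩

end Game

/-- The first `n` symbols of a sequence. -/
def firstSymbols (n : ℕ) (ω : ℕ → Bool) : Fin n → Bool := fun k => ω k

lemma measurable_firstSymbols (n : ℕ) : Measurable (firstSymbols n) :=
  measurable_pi_lambda _ fun _ => measurable_pi_apply _

lemma measurable_shiftSeq (l : ℕ) : Measurable (shiftSeq l) :=
  measurable_pi_lambda _ fun _ => measurable_pi_apply _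

lemma preimage_image_firstSymbols {n : ℕ} {A : Set (ℕ → Bool)}
    (hA : ∀ ω ω', (∀ k < n, ω k = ω' k) → (ω ∈ A ↔ ω' ∈ A)) :
    firstSymbols n ⁻¹' (firstSymbols n '' A) = A := by
  refine Set.Subset.antisymm ?_ (Set.subset_preimage_image _ _)
  rintro ω ⟨ω', hω', h⟩
  exact (hA ω' ω fun k hk => congrFun h ⟨k, hk⟩).1 hω'

lemma measurableSet_of_firstSymbols {n : ℕ} {A : Set (ℕ → Bool)}
    (hA : ∀ ω ω', (∀ k < n, ω k = ω' k) → (ω ∈ A ↔ ω' ∈ A)) : MeasurableSet A := by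
  rw [← preimage_image_firstSymbols hA]
  exact measurable_firstSymbols n (Set.toFinite _).measurableSet

section CoinTossing

variable {μ : Measure (ℕ → Bool)} [IsProbabilityMeasure μ] {w : Bool → ℝ≥0∞}

lemma map_firstSymbols_shiftSeq
    (hμ : ∀ (n : ℕ) (b : ℕ → Bool), μ {ω | ∀ i < n, ω i = b i} = ∏ i ∈ Finset.range n, w (b i))
    (l k : ℕ) :
    μ.map (fun ω => (firstSymbols l ω, firstSymbols k (shiftSeq l ω))) =
      (μ.map (firstSymbols l)).prod (μ.map (firstSymbols k)) := by
  have hcyl : ∀ (n : ℕ) (b : ℕ → Bool),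
      firstSymbols n ⁻¹' {firstSymbols n b} = {ω | ∀ i < n, ω i = b i} := fun n b => by
    ext ω
    simp [firstSymbols, funext_iff, Fin.forall_iff]
  have hsurj : ∀ n (a : Fin n → Bool), ∃ b, firstSymbols n b = a := fun n a =>
    ⟨fun t => if h : t < n then a ⟨t, h⟩ else false, by ext t; simp [firstSymbols]⟩
  have hmeas : Measurable fun ω => (firstSymbols l ω, firstSymbols k (shiftSeq l ω)) :=
    (measurable_firstSymbols l).prodMk
      ((measurable_firstSymbols k).comp (measurable_shiftSeq l))
  refine Measure.ext_of_singleton fun ⟨a, b⟩ => ?_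
  obtain ⟨a, rfl⟩ := hsurj l a
  obtain ⟨b, rfl⟩ := hsurj k b
  have hpre : (fun ω => (firstSymbols l ω, firstSymbols k (shiftSeq l ω))) ⁻¹'
      {(firstSymbols l a, firstSymbols k b)} =
      {ω | ∀ i < l + k, ω i = if i < l then a i else b (i - l)} := by
    ext ω
    simp only [Set.mem_preimage, Set.mem_singleton_iff, Prod.mk.injEq, firstSymbols, shiftSeq,
      funext_iff, Fin.forall_iff, Set.mem_ofPred_eq]
    constructor
    · rintro ⟨h₁, h₂⟩ i hi
      split_ifs with hil
      · exact h₁ i hil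
      · rw [← h₂ (i - l) (by omega), Nat.add_sub_cancel' (by omega)]
    · refine fun h => ⟨fun i hi => ?_, fun i hi => ?_⟩
      · simpa [hi] using h i (by omega)
      · simpa using h (l + i) (by omega)
  rw [← Set.singleton_prod_singleton, Measure.prod_prod, Set.singleton_prod_singleton,
    Measure.map_apply hmeas (MeasurableSet.singleton _), hpre,
    Measure.map_apply (measurable_firstSymbols l) (MeasurableSet.singleton _),
    Measure.map_apply (measurable_firstSymbols k) (MeasurableSet.singleton _),
    hcyl, hcyl, hμ, hμ, hμ, Finset.prod_range_add]
  congr 1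
  · exact Finset.prod_congr rfl fun t ht => by rw [if_pos (Finset.mem_range.1 ht)]
  · simp

/-- An event determined by the first `l` trials is independent of an event determined by the
`k` trials that follow. -/
lemma measure_inter_preimage_shiftSeq
    (hμ : ∀ (n : ℕ) (b : ℕ → Bool), μ {ω | ∀ i < n, ω i = b i} = ∏ i ∈ Finset.range n, w (b i))
    {l k : ℕ} {A B : Set (ℕ → Bool)}
    (hA : ∀ ω ω', (∀ t < l, ω t = ω' t) → (ω ∈ A ↔ ω' ∈ A))
    (hB : ∀ ω ω', (∀ t < k, ω t = ω' t) → (ω ∈ B ↔ ω' ∈ B)) :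
    μ (A ∩ shiftSeq l ⁻¹' B) = μ A * μ B := by
  have hmeas : Measurable fun ω => (firstSymbols l ω, firstSymbols k (shiftSeq l ω)) :=
    (measurable_firstSymbols l).prodMk
      ((measurable_firstSymbols k).comp (measurable_shiftSeq l))
  have hfin : ∀ {n : ℕ} (s : Set (Fin n → Bool)), MeasurableSet s := fun s =>
    (Set.toFinite s).measurableSet
  have h := congrArg (fun ν => ν ((firstSymbols l '' A) ×ˢ (firstSymbols k '' B)))
    (map_firstSymbols_shiftSeq hμ l k)
  simp only [Measure.prod_prod] at h
  rw [Measure.map_apply hmeas ((hfin _).prod (hfin _)),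
    Measure.map_apply (measurable_firstSymbols l) (hfin _),
    Measure.map_apply (measurable_firstSymbols k) (hfin _),
    preimage_image_firstSymbols hA, preimage_image_firstSymbols hB, Set.mk_preimage_prod,
    preimage_image_firstSymbols hA] at h
  rw [← h]
  nth_rw 1 [← preimage_image_firstSymbols hB]
  rfl

end CoinTossing

theorem stmt9 (p : ℝ) (hp0 : 0 < p) (hp1 : p < 1)
    (μ : Measure (ℕ → Bool)) [IsProbabilityMeasure μ]
    (hμ : ∀ (n : ℕ) (b : ℕ → Bool),
      μ {ω | ∀ i < n, ω i = b i}
        = ∏ i ∈ Finset.range n, (if b i then ENNReal.ofReal p else ENNReal.ofReal (1 - p)))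
    (m : ℕ) (S : Fin m → List Bool) (hS : ∀ i, S i ≠ [])
    (hsub : ∀ i j, i ≠ j → ¬ S i <:+: S j)
    (i : Fin m) (n : ℕ) (hn : 1 ≤ n) :
    f μ (S i) n
      = (∑ j ∈ Finset.univ.erase i, ∑ ℓ ∈ Finset.Icc 1 n,
          x μ S j ℓ * fCond μ (S i) (sqcap (S j) (S i)) (n - ℓ)) + x μ S i n := by
  classical
  let A : Fin m → ℕ → Set (ℕ → Bool) := fun j l => {ω | winsAt S j ω l}
  let B : Fin m → ℕ → Set (ℕ → Bool) := fun j l =>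
    {ω | headOcc (S i) (sqcap (S j) (S i)) ω = ((n - l : ℕ) : ℕ∞)}
  have hA : ∀ j l ω ω', (∀ t < l, ω t = ω' t) → (ω ∈ A j l ↔ ω' ∈ A j l) :=
    fun j l ω ω' h => winsAt_congr h
  have hB : ∀ j l ω ω', (∀ t < n - l, ω t = ω' t) → (ω ∈ B j l ↔ ω' ∈ B j l) :=
    fun j l ω ω' h => headOcc_congr h
  have hAmeas : ∀ j l, MeasurableSet (A j l) := fun j l => measurableSet_of_firstSymbols (hA j l)
  have hmeas : ∀ j l, MeasurableSet (A j l ∩ shiftSeq l ⁻¹' B j l) := fun j l =>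
    (hAmeas j l).inter (measurable_shiftSeq l (measurableSet_of_firstSymbols (hB j l)))
  have hset : {ω | firstOcc (S i) ω = (n : ℕ∞)} =
      (⋃ c ∈ Finset.univ.erase i ×ˢ Finset.Icc 1 n, A c.1 c.2 ∩ shiftSeq c.2 ⁻¹' B c.1 c.2) ∪
        A i n := by
    ext ω
    rw [Set.mem_ofPred_eq, firstOcc_eq_iff_winsAt hS hsub]
    simp only [Set.mem_union, Set.mem_iUnion, Finset.mem_product, Finset.mem_erase,
      Finset.mem_univ, and_true, Prod.exists, exists_prop, A, B, Set.mem_inter_iff,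
      Set.mem_preimage, Set.mem_ofPred_eq]
    refine or_congr_left ⟨?_, ?_⟩
    · rintro ⟨j, hj, l, hl, h⟩
      exact ⟨j, l, ⟨hj, hl⟩, h⟩
    · rintro ⟨j, l, ⟨hj, hl⟩, h⟩
      exact ⟨j, hj, l, hl, h⟩
  have hdisj : ∀ c d : Fin m × ℕ, c ≠ d → Disjoint (A c.1 c.2) (A d.1 d.2) := fun c d hcd =>
    Set.disjoint_left.2 fun ω hc hd =>
      hcd (Prod.ext (winsAt_unique hsub hc hd).1 (winsAt_unique hsub hc hd).2)
  rw [f, hset, measure_union _ (hAmeas i n), measure_biUnion_finset _ fun c _ => hmeas c.1 c.2,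
    Finset.sum_product]
  · congr 1
    exact Finset.sum_congr rfl fun j _ => Finset.sum_congr rfl fun l _ =>
      measure_inter_preimage_shiftSeq
        (w := fun c => if c then ENNReal.ofReal p else ENNReal.ofReal (1 - p)) hμ (hA j l) (hB j l)
  · exact fun c _ d _ hcd =>
      (hdisj c d hcd).mono Set.inter_subset_left Set.inter_subset_left
  · simp only [Set.disjoint_iUnion_left]
    intro c hc
    refine (hdisj c (i, n) ?_).mono_left Set.inter_subset_left
    rintro rfl
    simp at hc
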